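/- Let s ≥ 1 and let t, z₁,…,z_s be indeterminates. Then the following identity holds in ℚ(t, z₁,…,z_s): ∑_{σ ∈ S_s} sgn(σ) ∏_{j=1}^{s} ( z_{σ(j)}^{s−j} / (1 − ∏_{l=1}^{j} z_{σ(l)}) ) · ∏_{1≤j<k≤s} ( t² z_{σ(j)} z_{σ(k)} − (1+t²) z_{σ(k)} + 1 ) = t^{s(s−1)/2} · ∏_{j=1}^{s} 1/(1 − z_j) · ∏_{1≤j<k≤s} (z_j − z_k) · t^{s(s−1)/2}·[normalization: equivalently with p = 1/(1+t²), q = t²/(1+t²), multiply both sides appropriately]. -/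

import Mathlib

open Finset

section TracyWidom

open Polynomial Matrix

/-- A polynomial interpolating `(1 - z k) * ∏ j ≠ k, (a z_j z_k - (1 + a) z_k + 1)` at the nodes
`z k`, with value `1 - ∏ z j` at `0`. -/
theorem exists_interpolating_polynomial {ι F : Type*} [DecidableEq ι] [Field F] (a : F)
    (z : ι → F) (S : Finset ι) :
    ∃ R : F[X], R.degree < #S ∧
      (∀ x, ∏ j ∈ S, (a * z j * x - (1 + a) * x + 1) =
        ∏ j ∈ S, (z j - x) + (1 - a * x) * R.eval x) ∧
      R.eval 0 = 1 - ∏ j ∈ S, z j ∧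
      ∀ k ∈ S, R.eval (z k) =
        (1 - z k) * ∏ j ∈ S.erase k, (a * z j * z k - (1 + a) * z k + 1) := by
  induction S using Finset.induction_on with
  | empty => exact ⟨0, by simp⟩
  | insert i S hi ih =>
    obtain ⟨R, hdeg, hR, h0, hk⟩ := ih
    refine ⟨(C (a * z i - (1 + a)) * X + C 1) * R + C (1 - z i) * ∏ j ∈ S, (C (z j) - X),
      ?_, fun x => ?_, ?_, fun k hkS => ?_⟩
    · rw [card_insert_of_notMem hi, ← mem_degreeLT]
      refine Submodule.add_mem _ (mem_degreeLT.2 ?_) (mem_degreeLT.2 ?_)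
      · rcases eq_or_ne R 0 with rfl | hR0
        · simp
        · refine (degree_mul_le _ _).trans_lt ?_
          rw [degree_eq_natDegree hR0] at hdeg ⊢
          have h1 : (C (a * z i - (1 + a)) * X + C 1).degree ≤ ((1 : ℕ) : WithBot ℕ) :=
            degree_linear_le
          refine (add_le_add_left h1 _).trans_lt ?_
          norm_cast at hdeg ⊢
          omega
      · rw [← smul_eq_C_mul]
        refine (degree_smul_le _ _).trans_lt ?_
        refine (degree_prod_le S fun j => C (z j) - X).trans_lt ?_
        refine (Finset.sum_le_card_nsmul S _ 1 fun j _ => ?_).trans_lt ?_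
        · exact (degree_sub_le _ _).trans (max_le (degree_C_le.trans zero_le_one) degree_X_le)
        · rw [nsmul_one]
          exact_mod_cast Nat.lt_succ_self _
    · simp only [prod_insert hi, hR, eval_add, eval_mul, eval_C, eval_X, eval_prod, eval_sub]
      ring
    · simp only [prod_insert hi, h0, eval_add, eval_mul, eval_C, eval_X, eval_prod, eval_sub,
        sub_zero]
      ring
    · simp only [eval_add, eval_mul, eval_C, eval_X, eval_prod, eval_sub]
      rcases eq_or_ne k i with rfl | hne
      · rw [erase_insert hi, hR]
        ring
      · have hkS : k ∈ S := (mem_insert.1 hkS).resolve_left hne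
        rw [prod_eq_zero hkS (sub_self _), hk k hkS, erase_insert_of_ne hne.symm,
          prod_insert (by simp [hi])]
        ring

theorem sum_prod_erase_eq_one_sub_prod {ι F : Type*} [DecidableEq ι] [Fintype ι] [Field F] (a : F)
    (z : ι → F) (hz : Function.Injective z) :
    ∑ k, (1 - z k) * ∏ j ∈ univ.erase k,
      (z j * (a * z k * z j - (1 + a) * z k + 1) / (z j - z k)) = 1 - ∏ j, z j := by
  obtain ⟨R, hdeg, -, h0, hk⟩ := exists_interpolating_polynomial a z univ
  rw [← h0, Lagrange.eq_interpolate hz.injOn hdeg, Lagrange.interpolate_apply, eval_finsetSum]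
  refine sum_congr rfl fun k _ => ?_
  rw [eval_mul, eval_C, hk k (mem_univ k), Lagrange.basis, eval_prod, mul_assoc,
    ← prod_mul_distrib]
  congr 1
  refine prod_congr rfl fun j hj => ?_
  have hne : z j - z k ≠ 0 := sub_ne_zero.2 (hz.ne (ne_of_mem_erase hj))
  have hne' : z k - z j ≠ 0 := sub_ne_zero.2 (hz.ne (ne_of_mem_erase hj).symm)
  simp only [Lagrange.basisDivisor, eval_mul, eval_C, eval_sub, eval_X]
  field_simp
  ring

theorem Fin.prod_swap_zero_succ {n : ℕ} {M : Type*} [CommMonoid M] (p : Fin (n + 1))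
    (g : Fin (n + 1) → M) :
    ∏ j : Fin n, g (Equiv.swap 0 p j.succ) = ∏ j ∈ univ.erase p, g j := by
  rw [← Fin.prod_Ioi_zero (fun j => g (Equiv.swap 0 p j))]
  refine prod_equiv (Equiv.swap 0 p) (fun i => ?_) fun _ _ => rfl
  simp [Equiv.swap_apply_eq_iff]

theorem Matrix.sign_swap_mul_det_vandermonde {n : ℕ} {F : Type*} [CommRing F] (p : Fin (n + 1))
    (w : Fin (n + 1) → F) :
    ((Equiv.Perm.sign (Equiv.swap 0 p) : ℤ) : F) * det (vandermonde w) =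
      (∏ j ∈ univ.erase p, (w j - w p)) *
        det (vandermonde fun j : Fin n => w (Equiv.swap 0 p j.succ)) := by
  rw [← Fin.prod_swap_zero_succ p fun j => w j - w p, ← det_permute]
  change det (vandermonde (w ∘ Equiv.swap 0 p)) = _
  rw [det_vandermonde, det_vandermonde, Fin.prod_univ_succ, Fin.prod_Ioi_zero]
  simp [Fin.prod_Ioi_succ]

/-- The Tracy–Widom identity for pairwise distinct variables, in its original variable order. -/
theorem sum_perm_eq_det_vandermonde {F : Type*} [Field F] (a : F) {n : ℕ} (w : Fin n → F)
    (hinj : Function.Injective w)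
    (hw : ∀ T : Finset (Fin n), T.Nonempty → 1 - ∏ l ∈ T, w l ≠ 0) :
    ∑ σ : Equiv.Perm (Fin n), ((Equiv.Perm.sign σ : ℤ) : F) *
        ((∏ j : Fin n, w (σ j) ^ j.val / (1 - ∏ l ∈ Ici j, w (σ l))) *
          ∏ j : Fin n, ∏ k ∈ Ioi j, (a * w (σ j) * w (σ k) - (1 + a) * w (σ j) + 1)) =
      (∏ j : Fin n, (1 - w j)⁻¹) * det (vandermonde w) := by
  induction n with
  | zero => simp
  | succ n ih =>
    have hall : 1 - ∏ l, w l ≠ 0 := hw univ univ_nonempty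
    have hone (p) : 1 - w p ≠ 0 := by simpa using hw {p} (singleton_nonempty p)
    rw [← Equiv.Perm.decomposeFin.symm.sum_comp, Fintype.sum_prod_type]
    have key (p : Fin (n + 1)) :
        ∑ e : Equiv.Perm (Fin n),
          ((Equiv.Perm.sign (Equiv.Perm.decomposeFin.symm (p, e)) : ℤ) : F) *
          ((∏ j, w (Equiv.Perm.decomposeFin.symm (p, e) j) ^ j.val /
              (1 - ∏ l ∈ Ici j, w (Equiv.Perm.decomposeFin.symm (p, e) l))) *
            ∏ j, ∏ k ∈ Ioi j, (a * w (Equiv.Perm.decomposeFin.symm (p, e) j) *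
              w (Equiv.Perm.decomposeFin.symm (p, e) k) -
              (1 + a) * w (Equiv.Perm.decomposeFin.symm (p, e) j) + 1)) =
        (∏ j, (1 - w j)⁻¹) * det (vandermonde w) * (1 - ∏ j, w j)⁻¹ *
          ((1 - w p) * ∏ j ∈ univ.erase p,
            (w j * (a * w p * w j - (1 + a) * w p + 1) / (w j - w p))) := by
      have hinj' : Function.Injective fun j : Fin n => w (Equiv.swap 0 p j.succ) :=
        hinj.comp ((Equiv.swap 0 p).injective.comp (Fin.succ_injective n))
      have ih' := ih (fun j => w (Equiv.swap 0 p j.succ)) hinj' fun T hT => by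
        simpa using hw (T.map ((Fin.succEmb n).trans (Equiv.swap 0 p).toEmbedding)) (hT.map)
      have hsign (e : Equiv.Perm (Fin n)) :
          ((Equiv.Perm.sign (Equiv.Perm.decomposeFin.symm (p, e)) : ℤ) : F) =
            ((Equiv.Perm.sign (Equiv.swap 0 p) : ℤ) : F) * ((Equiv.Perm.sign e : ℤ) : F) := by
        rw [Equiv.Perm.decomposeFin.symm_sign, Equiv.Perm.sign_swap']
        simp only [eq_comm (a := (0 : Fin (n + 1)))]
        split_ifs <;> simp
      have hsq : ((Equiv.Perm.sign (Equiv.swap 0 p) : ℤ) : F) *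
          ((Equiv.Perm.sign (Equiv.swap 0 p) : ℤ) : F) = 1 := by
        rw [← Int.cast_mul, ← Units.val_mul, Int.units_mul_self]; simp
      have hV := sign_swap_mul_det_vandermonde p w
      have hne : ∏ j ∈ univ.erase p, (w j - w p) ≠ 0 :=
        prod_ne_zero_iff.2 fun j hj => sub_ne_zero.2 (hinj.ne (ne_of_mem_erase hj))
      have hterm (e : Equiv.Perm (Fin n)) :
          ((∏ j, w (Equiv.Perm.decomposeFin.symm (p, e) j) ^ j.val /
              (1 - ∏ l ∈ Ici j, w (Equiv.Perm.decomposeFin.symm (p, e) l))) *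
            ∏ j, ∏ k ∈ Ioi j, (a * w (Equiv.Perm.decomposeFin.symm (p, e) j) *
              w (Equiv.Perm.decomposeFin.symm (p, e) k) -
              (1 + a) * w (Equiv.Perm.decomposeFin.symm (p, e) j) + 1)) =
          (1 - ∏ j, w j)⁻¹ * (∏ j ∈ univ.erase p, w j) *
            (∏ j ∈ univ.erase p, (a * w p * w j - (1 + a) * w p + 1)) *
          ((∏ j : Fin n, w (Equiv.swap 0 p (e j).succ) ^ j.val /
              (1 - ∏ l ∈ Ici j, w (Equiv.swap 0 p (e l).succ))) *
            ∏ j : Fin n, ∏ k ∈ Ioi j, (a * w (Equiv.swap 0 p (e j).succ) *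
              w (Equiv.swap 0 p (e k).succ) -
              (1 + a) * w (Equiv.swap 0 p (e j).succ) + 1)) := by
        have hIci : (Ici (0 : Fin (n + 1))) = univ := by ext; simp
        rw [Fin.prod_univ_succ, Fin.prod_univ_succ (n := n) (f := fun j => ∏ k ∈ Ioi j, _),
          Fin.prod_Ioi_zero, hIci, 
          Equiv.prod_comp (Equiv.Perm.decomposeFin.symm (p, e)) w]
        simp only [Fin.prod_Ici_succ, Fin.prod_Ioi_succ, Equiv.Perm.decomposeFin_symm_apply_zero,
          Equiv.Perm.decomposeFin_symm_apply_succ, Fin.val_zero, pow_zero, Fin.val_succ, pow_succ,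
          mul_div_right_comm, prod_mul_distrib]
        rw [Equiv.prod_comp e fun j => w (Equiv.swap 0 p j.succ),
          Equiv.prod_comp e fun j => a * w p * w (Equiv.swap 0 p j.succ) - (1 + a) * w p + 1,
          Fin.prod_swap_zero_succ p w,
          Fin.prod_swap_zero_succ p fun j => a * w p * w j - (1 + a) * w p + 1]
        ring
      have hpull (u K : F) (v T : Equiv.Perm (Fin n) → F) :
          ∑ e, u * v e * (K * T e) = u * K * ∑ e, v e * T e := by
        rw [mul_sum]
        exact sum_congr rfl fun e _ => mul_mul_mul_comm _ _ _ _
      simp only [hsign, hterm]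
      rw [hpull, ih', Fin.prod_swap_zero_succ p fun j => (1 - w j)⁻¹,
        ← mul_prod_erase univ (fun j => (1 - w j)⁻¹) (mem_univ p), prod_div_distrib,
        prod_mul_distrib]
      have hp := hone p
      generalize (∏ j ∈ univ.erase p, (1 - w j)⁻¹) = A at *
      generalize (∏ j ∈ univ.erase p, w j) = B at *
      generalize (∏ j ∈ univ.erase p, (w j - w p)) = D at *
      generalize (∏ j ∈ univ.erase p, (a * w p * w j - (1 + a) * w p + 1)) = E at *
      generalize ((Equiv.Perm.sign (Equiv.swap 0 p) : ℤ) : F) = u at *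
      generalize det (vandermonde w) = V at *
      generalize det (vandermonde fun j : Fin n => w (Equiv.swap 0 p j.succ)) = V' at *
      have hV' : V = u * (D * V') := by rw [← hV, ← mul_assoc, hsq, one_mul]
      rw [hV']
      field_simp
    simp only [key]
    rw [← mul_sum, sum_prod_erase_eq_one_sub_prod a w hinj, inv_mul_cancel_right₀ hall]

theorem Fin.prod_prod_Ioi_rev {n : ℕ} {M : Type*} [CommMonoid M] (g : Fin n → Fin n → M) :
    ∏ j, ∏ k ∈ Ioi j, g (Fin.rev k) (Fin.rev j) = ∏ j, ∏ k ∈ Ioi j, g j k := by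
  rw [prod_comm' (t' := univ) (s' := fun k => Iio k) (by simp), ← Equiv.prod_comp Fin.revPerm]
  refine prod_congr rfl fun j _ => ?_
  rw [Fin.revPerm_apply, ← Fin.map_revPerm_Ioi, prod_map]
  simp

end TracyWidom

/-- Tracy–Widom identity in the six-vertex parametrization (with `p = 1/(1+t²)`,
`q = t²/(1+t²)`, rescaled by `(1+t²)` per factor):
`Asym[∏_j z_j^{s-j}/(1-∏_{l≤j}z_l) · ∏_{j<k}(t²z_jz_k - (1+t²)z_k + 1)]
  = ∏_j (1-z_j)⁻¹ ∏_{j<k}(z_j - z_k)`. -/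
theorem stmt14 (s : ℕ) (hs : 1 ≤ s) (F : Type*) [Field F] [CharZero F]
    (t : F) (z : Fin s → F)
    (hz : ∀ T : Finset (Fin s), T.Nonempty → 1 - ∏ l ∈ T, z l ≠ 0) :
    ∑ σ : Equiv.Perm (Fin s), ((Equiv.Perm.sign σ : ℤ) : F) *
        ((∏ j : Fin s, z (σ j) ^ (s - (j.val + 1)) / (1 - ∏ l ∈ Iic j, z (σ l))) *
          ∏ j : Fin s, ∏ k ∈ Ioi j,
            (t ^ 2 * z (σ j) * z (σ k) - (1 + t ^ 2) * z (σ k) + 1)) =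
      (∏ j : Fin s, (1 - z j)⁻¹) * ∏ j : Fin s, ∏ k ∈ Ioi j, (z j - z k) := by
  have key : (∑ σ : Equiv.Perm (Fin s), ((Equiv.Perm.sign σ : ℤ) : F) *
        ((∏ j : Fin s, z (σ j) ^ (s - (j.val + 1)) / (1 - ∏ l ∈ Iic j, z (σ l))) *
          ∏ j : Fin s, ∏ k ∈ Ioi j,
            (t ^ 2 * z (σ j) * z (σ k) - (1 + t ^ 2) * z (σ k) + 1))) =
      ∑ σ : Equiv.Perm (Fin s), ((Equiv.Perm.sign σ : ℤ) : F) *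
        ((∏ j : Fin s, z (σ j).rev ^ j.val / (1 - ∏ l ∈ Ici j, z (σ l).rev)) *
          ∏ j : Fin s, ∏ k ∈ Ioi j,
            (t ^ 2 * z (σ j).rev * z (σ k).rev - (1 + t ^ 2) * z (σ j).rev + 1)) := by
    rw [← Equiv.sum_comp (Equiv.permCongr Fin.revPerm)]
    refine sum_congr rfl fun σ _ => ?_
    rw [Equiv.Perm.sign_permCongr, ← Equiv.prod_comp Fin.revPerm, ← Fin.prod_prod_Ioi_rev]
    simp only [Equiv.permCongr_apply, Fin.revPerm_apply, Fin.revPerm_symm, Fin.rev_rev]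
    congr 2
    · refine prod_congr rfl fun j _ => ?_
      rw [← Fin.map_revPerm_Ici, prod_map]
      simp only [Equiv.coe_toEmbedding, Fin.revPerm_apply, Fin.rev_rev, Fin.val_rev]
      congr 2
      omega
    · refine prod_congr rfl fun j _ => prod_congr rfl fun k _ => ?_
      ring
  by_cases hinj : Function.Injective z
  · rw [key]
    have := sum_perm_eq_det_vandermonde (t ^ 2) (fun j => z j.rev)
      (hinj.comp Fin.rev_injective) fun T hT => by
        simpa using hz (T.map Fin.revPerm.toEmbedding) hT.map
    rw [this, Matrix.det_vandermonde, ← Fin.prod_prod_Ioi_rev,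
      ← Equiv.prod_comp Fin.revPerm fun j => (1 - z j)⁻¹]
    simp
  · obtain ⟨a, b, hab, hne⟩ := Function.not_injective_iff.1 hinj
    have hswap (i) : z (Equiv.swap a b i) = z i := by
      rw [Equiv.swap_apply_def]
      split_ifs <;> simp_all
    have hR : ∏ j : Fin s, ∏ k ∈ Ioi j, (z j - z k) = 0 := by
      rcases lt_or_gt_of_ne hne with h | h
      · exact prod_eq_zero (mem_univ a) (prod_eq_zero (mem_Ioi.2 h) (sub_eq_zero.2 hab))
      · exact prod_eq_zero (mem_univ b) (prod_eq_zero (mem_Ioi.2 h) (sub_eq_zero.2 hab.symm))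
    rw [hR, mul_zero, ← self_eq_neg, ← sum_neg_distrib,
      ← Equiv.sum_comp (Equiv.mulLeft (Equiv.swap a b))]
    refine sum_congr rfl fun σ _ => ?_
    simp [hswap, hne]
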